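/- Let k be a field, R an associative unital k-algebra, and M, N finitely generated left R-modules such that M^{⊕n} ⇒_deg N^{⊕n} for some integer n > 0. Then 𝒞(N) ⊆ 𝒞(M). -/

import Mathlib

open Polynomial TensorProduct

noncomputable section

/-- The prime ideal `(t)` of the polynomial ring `k[t]`. -/
def tIdeal (k : Type) [Field k] : Ideal (Polynomial k) := Ideal.span {Polynomial.X}

instance tIdeal_isPrime (k : Type) [Field k] : (tIdeal k).IsPrime := by
  have h : tIdeal k = RingHom.ker (Polynomial.evalRingHom (0 : k)) := by
    rw [Polynomial.ker_evalRingHom]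
    simp [tIdeal]
  rw [h]
  exact RingHom.ker_isPrime _

/-- `V = k[t]_{(t)}`, the localization of the polynomial ring `k[t]` at the prime ideal `(t)`. -/
def DegV (k : Type) [Field k] : Type := Localization.AtPrime (tIdeal k)

instance (k : Type) [Field k] : CommRing (DegV k) :=
  inferInstanceAs (CommRing (Localization.AtPrime (tIdeal k)))

instance (k : Type) [Field k] : Algebra (Polynomial k) (DegV k) :=
  inferInstanceAs (Algebra (Polynomial k) (Localization.AtPrime (tIdeal k)))

instance (k : Type) [Field k] : Algebra k (DegV k) :=
  inferInstanceAs (Algebra k (Localization.AtPrime (tIdeal k)))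

instance (k : Type) [Field k] : IsScalarTower k (Polynomial k) (DegV k) :=
  inferInstanceAs (IsScalarTower k (Polynomial k) (Localization.AtPrime (tIdeal k)))

/-- The element `t` of `V = k[t]_{(t)}`. -/
def degT (k : Type) [Field k] : DegV k := algebraMap (Polynomial k) (DegV k) Polynomial.X

/-- `K = V[t⁻¹]`, which is the fraction field `k(t)` of `V = k[t]_{(t)}`. -/
def DegK (k : Type) [Field k] : Type := Localization (Submonoid.powers (degT k))

instance (k : Type) [Field k] : CommRing (DegK k) :=
  inferInstanceAs (CommRing (Localization (Submonoid.powers (degT k))))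

instance (k : Type) [Field k] : Algebra (DegV k) (DegK k) :=
  inferInstanceAs (Algebra (DegV k) (Localization (Submonoid.powers (degT k))))

instance (k : Type) [Field k] : Algebra k (DegK k) :=
  inferInstanceAs (Algebra k (Localization (Submonoid.powers (degT k))))

/-- The localized module `Q[t⁻¹]` is a module over `K = V[t⁻¹]`. -/
instance (k : Type) [Field k] (Q : Type) [AddCommGroup Q] [Module (DegV k) Q] :
    Module (DegK k) (LocalizedModule (Submonoid.powers (degT k)) Q) :=
  inferInstanceAs (Module (Localization (Submonoid.powers (degT k)))
    (LocalizedModule (Submonoid.powers (degT k)) Q))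

section

variable (k : Type) [Field k] (R : Type) [Ring R] [Algebra k R]

/-- `1 ⊗ t` is central in `R ⊗[k] V`. -/
theorem degT_central (x : R ⊗[k] DegV k) :
    x * ((1 : R) ⊗ₜ[k] degT k) = ((1 : R) ⊗ₜ[k] degT k) * x := by
  induction x with
  | zero => simp
  | tmul a v => simp [Algebra.TensorProduct.tmul_mul_tmul, mul_comm]
  | add x y hx hy => simp [add_mul, mul_add, hx, hy]

/-- Multiplication by `1 ⊗ t` on an `R ⊗[k] V`-module, as an `R ⊗[k] V`-linear map. -/
def tSmul (Q : Type) [AddCommGroup Q] [Module (R ⊗[k] DegV k) Q] :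
    Q →ₗ[R ⊗[k] DegV k] Q where
  toFun q := ((1 : R) ⊗ₜ[k] degT k) • q
  map_add' := smul_add _
  map_smul' x q := by
    simp only [RingHom.id_apply, ← mul_smul, degT_central]

/-- The `R`-module structure on an `R ⊗[k] V`-module obtained by restriction of scalars
along `R → R ⊗[k] V`. -/
def rRestrict (Q : Type) [AddCommGroup Q] [Module (R ⊗[k] DegV k) Q] : Module R Q :=
  Module.compHom Q (Algebra.TensorProduct.includeLeftRingHom : R →+* R ⊗[k] DegV k)

/-- The `V`-module structure on an `R ⊗[k] V`-module obtained by restriction of scalars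
along `V → R ⊗[k] V`. -/
def vRestrict (Q : Type) [AddCommGroup Q] [Module (R ⊗[k] DegV k) Q] : Module (DegV k) Q :=
  Module.compHom Q
    ((Algebra.TensorProduct.includeRight : DegV k →ₐ[k] R ⊗[k] DegV k) : DegV k →+* R ⊗[k] DegV k)

/-- The action of `r : R` on an `R ⊗[k] V`-module `Q`, as a `V`-linear endomorphism of `Q`. -/
def rAct (Q : Type) [AddCommGroup Q] [Module (R ⊗[k] DegV k) Q] (r : R) :
    letI := vRestrict k R Q
    Q →ₗ[DegV k] Q :=
  letI := vRestrict k R Q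
  { toFun := fun q => (r ⊗ₜ[k] (1 : DegV k)) • q
    map_add' := smul_add _
    map_smul' := fun v q => by
      show (r ⊗ₜ[k] (1 : DegV k)) • (((1 : R) ⊗ₜ[k] v) • q)
        = ((1 : R) ⊗ₜ[k] v) • ((r ⊗ₜ[k] (1 : DegV k)) • q)
      rw [← mul_smul, ← mul_smul, Algebra.TensorProduct.tmul_mul_tmul,
        Algebra.TensorProduct.tmul_mul_tmul, one_mul, mul_one, one_mul, mul_one] }

/-- The action of `r : R` on a module `M`, as a `k`-linear endomorphism of `M`
(where `M` is viewed as a `k`-module by restriction of scalars along `k → R`). -/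
def rActK (M : Type) [AddCommGroup M] [Module R M] (r : R) :
    letI := Module.compHom M (algebraMap k R)
    M →ₗ[k] M :=
  letI := Module.compHom M (algebraMap k R)
  { toFun := fun m => r • m
    map_add' := smul_add r
    map_smul' := fun c m => by
      show r • ((algebraMap k R c) • m) = (algebraMap k R c) • (r • m)
      rw [← mul_smul, ← mul_smul, Algebra.commutes] }

/-- Degeneration of modules (Yoshino): `M ⇒_deg N` iff there is a finitely generated
`R ⊗[k] V`-module `Q`, flat over `V`, with `Q/tQ ≅ N` as `R`-modules and
`Q_t = Q[t⁻¹] ≅ M ⊗[k] K` compatibly with the `R`- and `K`-actions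
(i.e. as `R ⊗[k] K`-modules). -/
def Degenerates (M N : Type) [AddCommGroup M] [Module R M] [AddCommGroup N] [Module R N] :
    Prop :=
  ∃ (Q : Type) (_ : AddCommGroup Q) (_ : Module (R ⊗[k] DegV k) Q),
    Module.Finite (R ⊗[k] DegV k) Q ∧
    (letI := vRestrict k R Q; Module.Flat (DegV k) Q) ∧
    -- `Q/tQ ≅ N` as `R`-modules
    (letI := rRestrict k R (Q ⧸ LinearMap.range (tSmul k R Q))
     Nonempty ((Q ⧸ LinearMap.range (tSmul k R Q)) ≃ₗ[R] N)) ∧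
    -- `Q_t ≅ M ⊗_k K` as `R ⊗_k K`-modules, i.e. compatibly with both actions
    (letI := vRestrict k R Q
     letI : Module k M := Module.compHom M (algebraMap k R)
     ∃ f : LocalizedModule (Submonoid.powers (degT k)) Q ≃+ (M ⊗[k] DegK k),
       (∀ (c : DegK k) (x : LocalizedModule (Submonoid.powers (degT k)) Q),
          f (c • x) = LinearMap.lTensor M (LinearMap.mulLeft k c) (f x)) ∧
       (∀ (r : R) (x : LocalizedModule (Submonoid.powers (degT k)) Q),
          f (LocalizedModule.map (Submonoid.powers (degT k)) (rAct k R Q r) x)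
            = LinearMap.rTensor (DegK k) (rActK k R M r) (f x)))

end

/-- A bundled finitely generated (left) `R`-module. -/
structure FGMod (R : Type) [Ring R] where
  carrier : Type
  [addCommGroup : AddCommGroup carrier]
  [module : Module R carrier]
  [finite : Module.Finite R carrier]

attribute [instance] FGMod.addCommGroup FGMod.module FGMod.finite

/-- The operator `𝒞` on sets of finitely generated `R`-modules:
`𝒞(𝒳)` consists of the f.g. modules `N` such that `M^{⊕n} ⇒_deg N^{⊕n}`
for some `M ∈ 𝒳` and some `n > 0`. -/
def CC (k : Type) [Field k] (R : Type) [Ring R] [Algebra k R] (X : Set (FGMod R)) :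
    Set (FGMod R) :=
  {N | ∃ M ∈ X, ∃ n : ℕ, 0 < n ∧
    Degenerates k R (Fin n → M.carrier) (Fin n → N.carrier)}

/-! ### Combinatorial lattices in `M[[t]]` -/

/-- Multiplication by `t` on sequences (formal power series with coefficients in `M`). -/
def seqShift {M : Type} [AddCommGroup M] (p : ℕ → M) : ℕ → M
  | 0 => 0
  | i + 1 => p i

/-- Combinatorial version of degeneration: the graph `Γ` of a surjection from a lattice in
`M[[t]]` onto `N` whose kernel is `t` times the lattice. -/
def DegB (R M N : Type) [Ring R] [AddCommGroup M] [Module R M] [AddCommGroup N] [Module R N] :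
    Prop :=
  ∃ (a : ℕ) (G : Submodule R ((ℕ → M) × N)),
    (∀ n, ((0 : ℕ → M), n) ∈ G → n = 0) ∧
    (∀ n, ∃ p, (p, n) ∈ G) ∧
    (∀ p n, (p, n) ∈ G → (seqShift p, (0 : N)) ∈ G) ∧
    (∀ p, (p, (0 : N)) ∈ G → ∃ q n, p = seqShift q ∧ (q, n) ∈ G) ∧
    (∀ p : ℕ → M, (∀ i < a, p i = 0) → ∃ n, (p, n) ∈ G)

section DegB

variable {R L M N : Type} [Ring R] [AddCommGroup M] [Module R M] [AddCommGroup N] [Module R N]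
  [AddCommGroup L] [Module R L]

theorem eq_seqShift {p : ℕ → M} (h : p 0 = 0) : p = seqShift (fun i => p (i + 1)) := by
  funext i
  cases i with
  | zero => simpa [seqShift] using h
  | succ i => rfl

theorem DegB.trans (h1 : DegB R M N) (h2 : DegB R N L) : DegB R M L := by
  obtain ⟨a, G, f1, s1, t1, k1, c1⟩ := h1
  obtain ⟨c, H, f2, s2, t2, k2, c2⟩ := h2
  have c1' : ∀ p : ℕ → M, (∀ i < a + 1, p i = 0) → (p, (0 : N)) ∈ G := by
    intro p hp
    obtain ⟨n, hn⟩ := c1 (fun i => p (i + 1)) (fun i hi => hp _ (by omega))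
    have := t1 _ _ hn
    rwa [← eq_seqShift (hp 0 (by omega))] at this
  have c2' : ∀ p : ℕ → N, (∀ i < c + 1, p i = 0) → (p, (0 : L)) ∈ H := by
    intro p hp
    obtain ⟨n, hn⟩ := c2 (fun i => p (i + 1)) (fun i hi => hp _ (by omega))
    have := t2 _ _ hn
    rwa [← eq_seqShift (hp 0 (by omega))] at this
  refine ⟨(c + 1) * (a + 1),
    { carrier := {x | ∃ w : ℕ → N, (∀ i < c + 1, ((fun n => x.1 ((c + 1) * n + i)), w i) ∈ G) ∧
        (w, x.2) ∈ H}
      zero_mem' := ⟨0, fun i _ => G.zero_mem, H.zero_mem⟩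
      add_mem' := ?_
      smul_mem' := ?_ }, ?_, ?_, ?_, ?_, ?_⟩
  · rintro x y ⟨w, hw, hw'⟩ ⟨v, hv, hv'⟩
    exact ⟨w + v, fun i hi => G.add_mem (hw i hi) (hv i hi), H.add_mem hw' hv'⟩
  · rintro r x ⟨w, hw, hw'⟩
    exact ⟨r • w, fun i hi => G.smul_mem r (hw i hi), H.smul_mem r hw'⟩
  · rintro l ⟨w, hw, hw'⟩
    have : (w, (0 : L)) ∈ H := c2' w (fun i hi => f1 _ (hw i hi))
    have h3 := H.sub_mem hw' this
    apply f2
    simpa using h3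
  · intro l
    obtain ⟨w, hw⟩ := s2 l
    choose P hP using s1
    refine ⟨fun m => P (w (m % (c + 1))) (m / (c + 1)), w, fun i hi => ?_, hw⟩
    convert hP (w i) using 2
    funext n
    simp only [Nat.mul_add_mod, Nat.mod_eq_of_lt hi]
    rw [Nat.mul_add_div (by omega), Nat.div_eq_of_lt hi, add_zero]
  · rintro p l ⟨w, hw, hw'⟩
    refine ⟨seqShift w, fun i hi => ?_, t2 _ _ hw'⟩
    cases i with
    | zero =>
      have := t1 _ _ (hw c (by omega))
      convert this using 2
      · funext n
        cases n with
        | zero => rfl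
        | succ n =>
          show seqShift p ((c + 1) * n + c + 1) = p ((c + 1) * n + c)
          rfl
      · rfl
    | succ i => exact hw i (by omega)
  · rintro p ⟨w, hw, hw'⟩
    obtain ⟨q, l, rfl, hq⟩ := k2 _ hw'
    obtain ⟨p', n', hp, hp'⟩ := k1 _ (hw 0 (by omega))
    have hp0 : p 0 = 0 := by
      have := congrFun hp 0
      simpa [seqShift] using this
    obtain ⟨l', hl'⟩ := c2 (Function.update q c n' - q) (fun i hi => by
      simp [Function.update_of_ne (Nat.ne_of_lt hi)])
    refine ⟨_, l' + l, eq_seqShift hp0, Function.update q c n', fun i hi => ?_, ?_⟩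
    · by_cases hic : i = c
      · subst hic
        rw [Function.update_self]
        convert hp' using 2
        funext n
        exact congrFun hp (n + 1)
      · rw [Function.update_of_ne hic]
        exact hw (i + 1) (by omega)
    · have := H.add_mem hl' hq
      simpa using this
  · intro p hp
    refine ⟨0, 0, fun i hi => c1' _ (fun n hn => hp _ ?_), H.zero_mem⟩
    calc (c + 1) * n + i < (c + 1) * n + (c + 1) := by omega
      _ = (c + 1) * (n + 1) := by ring
      _ ≤ _ := Nat.mul_le_mul_left _ hn

theorem DegB.pi (h : DegB R M N) (m : ℕ) : DegB R (Fin m → M) (Fin m → N) := by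
  obtain ⟨a, G, f1, s1, t1, k1, c1⟩ := h
  refine ⟨a, { carrier := {x | ∀ j, ((fun i => x.1 i j), x.2 j) ∈ G}
               zero_mem' := fun j => G.zero_mem
               add_mem' := fun hx hy j => G.add_mem (hx j) (hy j)
               smul_mem' := fun r x hx j => G.smul_mem r (hx j) }, ?_, ?_, ?_, ?_, ?_⟩
  · intro n hn
    funext j
    exact f1 _ (hn j)
  · intro n
    choose P hP using s1
    exact ⟨fun i j => P (n j) i, fun j => hP (n j)⟩
  · intro p n hp j
    convert t1 _ _ (hp j) using 2
    · funext i
      cases i <;> rfl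
    · rfl
  · intro p hp
    choose q n hq hn using fun j => k1 _ (hp j)
    refine ⟨fun i j => q j i, n, ?_, hn⟩
    funext i j
    have := congrFun (hq j) i
    cases i <;> exact this
  · intro p hp
    choose n hn using fun j => c1 (fun i => p i j) (fun i hi => congrFun (hp i hi) j)
    exact ⟨n, hn⟩

theorem DegB.congr {M' N' : Type} [AddCommGroup M'] [Module R M'] [AddCommGroup N'] [Module R N']
    (h : DegB R M N) (e : M' ≃ₗ[R] M) (g : N' ≃ₗ[R] N) : DegB R M' N' := by
  obtain ⟨a, G, f1, s1, t1, k1, c1⟩ := h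
  refine ⟨a, { carrier := {x | ((fun i => e (x.1 i)), g x.2) ∈ G}
               zero_mem' := ?_
               add_mem' := ?_
               smul_mem' := ?_ }, ?_, ?_, ?_, ?_, ?_⟩
  · intro x y hx hy
    have := G.add_mem hx hy
    simp only [Set.mem_ofPred_eq, Prod.fst_add, Prod.snd_add, Pi.add_apply, map_add]
    exact this
  · simp only [Set.mem_ofPred_eq, Prod.fst_zero, Prod.snd_zero, Pi.zero_apply, map_zero]
    exact G.zero_mem
  · intro r x hx
    have := G.smul_mem r hx
    simp only [Set.mem_ofPred_eq, Prod.smul_fst, Prod.smul_snd, Pi.smul_apply, map_smul]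
    exact this
  · intro n hn
    have : ((fun i => e ((0 : ℕ → M') i)), g n) ∈ G := hn
    simp only [Pi.zero_apply, map_zero] at this
    simpa using f1 _ this
  · intro n
    obtain ⟨p, hp⟩ := s1 (g n)
    refine ⟨fun i => e.symm (p i), ?_⟩
    simpa using hp
  · intro p n hp
    have := t1 _ _ hp
    show ((fun i => e (seqShift p i)), g 0) ∈ G
    convert this using 2
    · funext i
      cases i <;> simp [seqShift]
    · simp
  · intro p hp
    have hp' : ((fun i => e (p i)), g 0) ∈ G := hp
    rw [map_zero] at hp'
    obtain ⟨q, n, hq, hn⟩ := k1 _ hp'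
    refine ⟨fun i => e.symm (q i), g.symm n, ?_, ?_⟩
    · funext i
      have := congrFun hq i
      cases i <;> simpa [seqShift, LinearEquiv.eq_symm_apply] using this
    · simpa using hn
  · intro p hp
    obtain ⟨n, hn⟩ := c1 (fun i => e (p i)) (fun i hi => by simp [hp i hi])
    exact ⟨g.symm n, by simpa using hn⟩

end DegB

/-! ### Abstract lattices with an expansion map -/

section Expansion

variable {R M N U : Type} [Ring R] [AddCommGroup M] [Module R M] [AddCommGroup N] [Module R N]
  [AddCommGroup U] [Module R U] (T : U →ₗ[R] U) (E : U →ₗ[R] (ℕ → M))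

theorem expand_iter_lt (hE : ∀ u, E (T u) = seqShift (E u)) (b : ℕ) :
    ∀ (u : U) (i : ℕ), i < b → E (T^[b] u) i = 0 := by
  induction b with
  | zero => intro u i hi; omega
  | succ b ih =>
    intro u i hi
    rw [Function.iterate_succ_apply', hE]
    cases i with
    | zero => rfl
    | succ i => exact ih u i (by omega)

theorem expand_iter_add (hE : ∀ u, E (T u) = seqShift (E u)) (b : ℕ) :
    ∀ (u : U) (i : ℕ), E (T^[b] u) (i + b) = E u i := by
  induction b with
  | zero => intro u i; rfl
  | succ b ih =>
    intro u i
    rw [Function.iterate_succ_apply', hE]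
    exact ih u i

theorem seqShift_inj {p q : ℕ → M} (h : seqShift p = seqShift q) : p = q := by
  funext i
  exact congrFun h (i + 1)

theorem expand_vanish (hE : ∀ u, E (T u) = seqShift (E u))
    (h0 : ∀ u, E u 0 = 0 → ∃ u', u = T u') (b : ℕ) :
    ∀ u : U, (∀ i < b, E u i = 0) → ∃ u', u = T^[b] u' := by
  induction b with
  | zero => intro u _; exact ⟨u, rfl⟩
  | succ b ih =>
    intro u hu
    obtain ⟨u', rfl⟩ := h0 u (hu 0 (by omega))
    obtain ⟨u'', rfl⟩ := ih u' (fun i hi => by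
      have := hu (i + 1) (by omega)
      rw [hE] at this
      exact this)
    exact ⟨u'', (Function.iterate_succ_apply' _ _ _).symm⟩

theorem expand_approx (hE : ∀ u, E (T u) = seqShift (E u))
    (h1 : ∀ m, ∃ u, E u 0 = m) (p : ℕ → M) (b : ℕ) :
    ∃ u, ∀ i < b, E u i = p i := by
  induction b with
  | zero => exact ⟨0, fun i hi => by omega⟩
  | succ b ih =>
    obtain ⟨u, hu⟩ := ih
    obtain ⟨u', hu'⟩ := h1 (p b - E u b)
    refine ⟨u + T^[b] u', fun i hi => ?_⟩
    rw [map_add, Pi.add_apply]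
    by_cases hib : i = b
    · subst hib
      have := expand_iter_add T E hE i u' 0
      rw [zero_add] at this
      rw [this, hu']
      abel
    · rw [expand_iter_lt T E hE b u' i (by omega), add_zero]
      exact hu i (by omega)

theorem DegB.of_lattice {Q : Type} [AddCommGroup Q] [Module R Q]
    (hE : ∀ u, E (T u) = seqShift (E u))
    (h0 : ∀ u, E u 0 = 0 → ∃ u', u = T u')
    (h1 : ∀ m, ∃ u, E u 0 = m)
    (h : Q →ₗ[R] U) (hinj : Function.Injective h) (TQ : Q → Q)
    (hT : ∀ q, h (TQ q) = T (h q)) (a : ℕ) (ha : ∀ u, ∃ q, h q = T^[a] u)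
    (π : Q →ₗ[R] N) (hπ : Function.Surjective π)
    (hker : ∀ q, π q = 0 ↔ ∃ q', q = TQ q') : DegB R M N := by
  refine ⟨a + 1,
    { carrier := {x | ∃ q, π q = x.2 ∧ ∀ i < a + 1, E (h q) i = x.1 i}
      zero_mem' := ⟨0, by simp, by simp⟩
      add_mem' := ?_
      smul_mem' := ?_ }, ?_, ?_, ?_, ?_, ?_⟩
  · rintro x y ⟨q, hq, hq'⟩ ⟨s, hs, hs'⟩
    refine ⟨q + s, by simp [hq, hs], fun i hi => ?_⟩
    simp [hq' i hi, hs' i hi]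
  · rintro r x ⟨q, hq, hq'⟩
    refine ⟨r • q, by simp [hq], fun i hi => ?_⟩
    simp [hq' i hi]
  · rintro n ⟨q, hq, hq'⟩
    obtain ⟨u, hu⟩ := expand_vanish T E hE h0 (a + 1) (h q) hq'
    obtain ⟨q', hq1⟩ := ha u
    rw [← show π q = n from hq, hker]
    refine ⟨q', hinj ?_⟩
    rw [hu, hT, hq1, Function.iterate_succ_apply']
  · intro n
    obtain ⟨q, rfl⟩ := hπ n
    exact ⟨E (h q), q, rfl, fun i _ => rfl⟩
  · rintro p n ⟨q, hq, hq'⟩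
    refine ⟨TQ q, (hker _).2 ⟨q, rfl⟩, fun i hi => ?_⟩
    rw [hT, hE]
    cases i with
    | zero => rfl
    | succ i => exact hq' i (by omega)
  · rintro p ⟨q, hq, hq'⟩
    obtain ⟨q1, rfl⟩ := (hker _).1 hq
    rw [hT, hE] at hq'
    have hp0 : p 0 = 0 := (hq' 0 (by omega)).symm
    obtain ⟨u, hu⟩ := h1 (p (a + 1) - E (h q1) a)
    obtain ⟨q2, hq2⟩ := ha u
    refine ⟨_, π (q1 + q2), eq_seqShift hp0, q1 + q2, rfl, fun i hi => ?_⟩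
    rw [map_add, map_add, hq2, Pi.add_apply]
    by_cases hia : i = a
    · subst hia
      have := expand_iter_add T E hE i u 0
      rw [zero_add] at this
      rw [this, hu]
      abel
    · rw [expand_iter_lt T E hE a u i (by omega), add_zero]
      exact hq' (i + 1) (by omega)
  · intro p hp
    exact ⟨0, 0, by simp, fun i hi => by simp [hp i hi]⟩

theorem DegB.lattice (hM : DegB R M N)
    (hE : ∀ u, E (T u) = seqShift (E u))
    (h0 : ∀ u, E u 0 = 0 → ∃ u', u = T u')
    (h1 : ∀ m, ∃ u, E u 0 = m) :
    ∃ (a : ℕ) (Q : Submodule R U) (π : Q →ₗ[R] N), Function.Surjective π ∧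
      (∀ u ∈ Q, T u ∈ Q) ∧ (∀ u : Q, π u = 0 ↔ ∃ u' ∈ Q, (u : U) = T u') ∧
      (∀ u, T^[a] u ∈ Q) := by
  obtain ⟨a, G, f1, s1, t1, k1, c1⟩ := hM
  have c1' : ∀ p : ℕ → M, (∀ i < a + 1, p i = 0) → (p, (0 : N)) ∈ G := by
    intro p hp
    obtain ⟨n, hn⟩ := c1 (fun i => p (i + 1)) (fun i hi => hp _ (by omega))
    have := t1 _ _ hn
    rwa [← eq_seqShift (hp 0 (by omega))] at this
  have uniq : ∀ p n n', (p, n) ∈ G → (p, n') ∈ G → n = n' := by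
    intro p n n' h h'
    have := G.sub_mem h h'
    exact sub_eq_zero.1 (f1 _ (by simpa using this))
  let Q : Submodule R U :=
    { carrier := {u | ∃ n, (E u, n) ∈ G}
      zero_mem' := ⟨0, by rw [map_zero]; exact G.zero_mem⟩
      add_mem' := by
        rintro x y ⟨n, hn⟩ ⟨m, hm⟩
        exact ⟨n + m, by rw [map_add]; exact G.add_mem hn hm⟩
      smul_mem' := by
        rintro r x ⟨n, hn⟩
        exact ⟨r • n, by rw [map_smul]; exact G.smul_mem r hn⟩ }
  have hQ : ∀ u : Q, ∃ n, (E (u : U), n) ∈ G := fun u => u.2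
  choose P hP using hQ
  let π : Q →ₗ[R] N :=
    { toFun := P
      map_add' := fun x y => uniq _ _ _ (hP _) (by
        have := G.add_mem (hP x) (hP y)
        rw [Submodule.coe_add, map_add]
        exact this)
      map_smul' := fun r x => uniq _ _ _ (hP _) (by
        have := G.smul_mem r (hP x)
        rw [Submodule.coe_smul, map_smul]
        exact this) }
  have hTQ : ∀ u ∈ Q, T u ∈ Q := by
    rintro u ⟨n, hn⟩
    exact ⟨0, by rw [hE]; exact t1 _ _ hn⟩
  refine ⟨a, Q, π, ?_, hTQ, ?_, ?_⟩
  · intro n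
    obtain ⟨p, hp⟩ := s1 n
    obtain ⟨u, hu⟩ := expand_approx T E hE h1 p (a + 1)
    have h2 := G.add_mem (c1' (E u - p) (fun i hi => by simp [hu i hi])) hp
    have h3 : (E u, n) ∈ G := by simpa using h2
    exact ⟨⟨u, n, h3⟩, uniq _ _ _ (hP _) h3⟩
  · intro u
    constructor
    · intro hu
      have h2 : (E (u : U), (0 : N)) ∈ G := by
        rw [← hu]
        exact hP u
      obtain ⟨q, n, hq, hn⟩ := k1 _ h2
      obtain ⟨u', hu'⟩ := h0 (u : U) (by rw [hq]; rfl)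
      refine ⟨u', ⟨n, ?_⟩, hu'⟩
      rw [hu', hE] at hq
      rwa [seqShift_inj hq]
    · rintro ⟨u', ⟨n, hn⟩, hu'⟩
      refine uniq _ _ _ (hP u) ?_
      rw [hu', hE]
      exact t1 _ _ hn
  · intro u
    exact c1 _ (expand_iter_lt T E hE a u)

end Expansion

/-! ### Facts about `V` and `K` -/

section VFacts

variable (k : Type) [Field k]

instance degV_isLocalization : IsLocalization.AtPrime (DegV k) (tIdeal k) :=
  inferInstanceAs (IsLocalization.AtPrime (Localization.AtPrime (tIdeal k)) (tIdeal k))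

instance degK_isLocalization : IsLocalization (Submonoid.powers (degT k)) (DegK k) :=
  inferInstanceAs (IsLocalization (Submonoid.powers (degT k))
    (Localization (Submonoid.powers (degT k))))

instance degK_scalarTower : IsScalarTower k (DegV k) (DegK k) :=
  inferInstanceAs (IsScalarTower k (DegV k) (Localization (Submonoid.powers (degT k))))

instance degV_isDomain : IsDomain (DegV k) :=
  IsLocalization.isDomain_localization (tIdeal k).primeCompl_le_nonZeroDivisors

instance degV_dedekind : IsDedekindDomain (DegV k) :=
  IsLocalization.isDedekindDomain k[X] (M := (tIdeal k).primeCompl)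
    (tIdeal k).primeCompl_le_nonZeroDivisors _

theorem mem_tIdeal (p : k[X]) : p ∈ tIdeal k ↔ p.coeff 0 = 0 := by
  rw [tIdeal, Ideal.mem_span_singleton, Polynomial.X_dvd_iff]

/-- Power series expansion on `V`. -/
def degExp : DegV k →+* PowerSeries k :=
  IsLocalization.lift (M := (tIdeal k).primeCompl) (S := DegV k)
    (g := (Polynomial.coeToPowerSeries.ringHom : k[X] →+* PowerSeries k)) (by
      rintro ⟨p, hp⟩
      have : p.coeff 0 ≠ 0 := fun h => hp ((mem_tIdeal k p).2 h)
      rw [PowerSeries.isUnit_iff_constantCoeff]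
      simpa using this)

theorem degExp_algebraMap (p : k[X]) : degExp k (algebraMap k[X] (DegV k) p) = p := by
  simp [degExp]

theorem degExp_degT : degExp k (degT k) = PowerSeries.X := by
  rw [degT, degExp_algebraMap]
  simp

theorem degExp_smul (c : k) (v : DegV k) : degExp k (c • v) = c • degExp k v := by
  rw [Algebra.smul_def, map_mul, IsScalarTower.algebraMap_apply k k[X] (DegV k),
    degExp_algebraMap, PowerSeries.smul_eq_C_mul]
  simp

/-- The coefficients of the power series expansion on `V`. -/
def degCoeff (i : ℕ) : DegV k →ₗ[k] k where
  toFun v := PowerSeries.coeff i (degExp k v)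
  map_add' x y := by simp
  map_smul' c x := by simp [degExp_smul]

theorem degCoeff_zero_t (v : DegV k) : degCoeff k 0 (degT k * v) = 0 := by
  simp [degCoeff, degExp_degT]

theorem degCoeff_succ_t (i : ℕ) (v : DegV k) :
    degCoeff k (i + 1) (degT k * v) = degCoeff k i v := by
  simp [degCoeff, degExp_degT, PowerSeries.coeff_succ_X_mul]

theorem degCoeff_one : degCoeff k 0 1 = 1 := by
  simp [degCoeff]

theorem deg_decomp (v : DegV k) :
    ∃ v', v = algebraMap k (DegV k) (degCoeff k 0 v) + degT k * v' := by
  suffices h : ∀ v : DegV k, degCoeff k 0 v = 0 → ∃ v', v = degT k * v' by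
    obtain ⟨v', hv'⟩ := h (v - algebraMap k (DegV k) (degCoeff k 0 v)) (by
      rw [map_sub, Algebra.algebraMap_eq_smul_one, map_smul, degCoeff_one]
      simp)
    exact ⟨v', by rw [← hv']; abel⟩
  intro v hv
  obtain ⟨p, s, rfl⟩ := IsLocalization.exists_mk'_eq (tIdeal k).primeCompl v
  have h1 : (p : PowerSeries k) = degExp k (IsLocalization.mk' (DegV k) p s) *
      degExp k (algebraMap k[X] (DegV k) s) := by
    rw [← map_mul, IsLocalization.mk'_spec, degExp_algebraMap]
  have h2 : p.coeff 0 = 0 := by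
    have := congrArg (PowerSeries.constantCoeff) h1
    rw [map_mul] at this
    have hv' : PowerSeries.constantCoeff (degExp k (IsLocalization.mk' (DegV k) p s)) = 0 := by
      simpa [degCoeff] using hv
    rw [hv', zero_mul] at this
    simpa using this
  obtain ⟨p', rfl⟩ := Polynomial.X_dvd_iff.2 h2
  refine ⟨IsLocalization.mk' (DegV k) p' s, ?_⟩
  rw [degT, IsLocalization.mul_mk'_eq_mk'_of_mul]

theorem degT_ne_zero : degT k ≠ 0 := by
  intro h
  have := degExp_degT k
  rw [h, map_zero] at this
  exact PowerSeries.X_ne_zero this.symm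

theorem degK_injective : Function.Injective (algebraMap (DegV k) (DegK k)) := by
  apply IsLocalization.injective (M := Submonoid.powers (degT k))
  exact powers_le_nonZeroDivisors_of_noZeroDivisors (degT_ne_zero k)

/-- The element `t` of `K`. -/
def kT : DegK k := algebraMap (DegV k) (DegK k) (degT k)

theorem kT_isUnit : IsUnit (kT k) :=
  IsLocalization.map_units (DegK k) (⟨degT k, Submonoid.mem_powers _⟩ : Submonoid.powers (degT k))

theorem degK_surj (c : DegK k) : ∃ (n : ℕ) (v : DegV k), kT k ^ n * c = algebraMap _ _ v := by
  obtain ⟨⟨v, ⟨_, n, rfl⟩⟩, h⟩ := IsLocalization.surj (Submonoid.powers (degT k)) c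
  refine ⟨n, v, ?_⟩
  rw [← h, kT, ← map_pow, mul_comm]

end VFacts

section Tensors

variable (k : Type) [Field k] (R : Type) [Ring R] [Algebra k R]
  (M : Type) [AddCommGroup M] [Module R M] [Module k M] [IsScalarTower k R M]

/-- Multiplication by `v` on `M ⊗ V`. -/
def vMul (v : DegV k) : M ⊗[k] DegV k →ₗ[R] M ⊗[k] DegV k :=
  TensorProduct.AlgebraTensorModule.lTensor R M (LinearMap.mulLeft k v)

/-- Multiplication by `c` on `M ⊗ K`. -/
def kMul (c : DegK k) : M ⊗[k] DegK k →ₗ[R] M ⊗[k] DegK k :=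
  TensorProduct.AlgebraTensorModule.lTensor R M (LinearMap.mulLeft k c)

/-- The inclusion `M ⊗ V → M ⊗ K`. -/
def vIncl : M ⊗[k] DegV k →ₗ[R] M ⊗[k] DegK k :=
  TensorProduct.AlgebraTensorModule.lTensor R M
    (IsScalarTower.toAlgHom k (DegV k) (DegK k)).toLinearMap

/-- Expansion of elements of `M ⊗ V`. -/
def expE : M ⊗[k] DegV k →ₗ[R] (ℕ → M) :=
  LinearMap.pi fun i =>
    (TensorProduct.AlgebraTensorModule.rid k R M).toLinearMap ∘ₗ
      TensorProduct.AlgebraTensorModule.lTensor R M (degCoeff k i)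

@[simp] theorem vMul_tmul (v w : DegV k) (m : M) : vMul k R M v (m ⊗ₜ w) = m ⊗ₜ (v * w) := rfl

@[simp] theorem kMul_tmul (v w : DegK k) (m : M) : kMul k R M v (m ⊗ₜ w) = m ⊗ₜ (v * w) := rfl

@[simp] theorem vIncl_tmul (w : DegV k) (m : M) :
    vIncl k R M (m ⊗ₜ w) = m ⊗ₜ (algebraMap _ _ w) := rfl

@[simp] theorem expE_tmul (w : DegV k) (m : M) (i : ℕ) :
    expE k R M (m ⊗ₜ w) i = degCoeff k i w • m := by
  simp [expE]

theorem vMul_mul (v w : DegV k) (x : M ⊗[k] DegV k) :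
    vMul k R M (v * w) x = vMul k R M v (vMul k R M w x) := by
  induction x with
  | zero => simp
  | tmul m u => simp [mul_assoc]
  | add x y hx hy => simp [hx, hy]

theorem kMul_mul (v w : DegK k) (x : M ⊗[k] DegK k) :
    kMul k R M (v * w) x = kMul k R M v (kMul k R M w x) := by
  induction x with
  | zero => simp
  | tmul m u => simp [mul_assoc]
  | add x y hx hy => simp [hx, hy]

theorem vMul_one (x : M ⊗[k] DegV k) : vMul k R M 1 x = x := by
  induction x with
  | zero => simp
  | tmul m u => simp
  | add x y hx hy => simp [hx, hy]

theorem kMul_one (x : M ⊗[k] DegK k) : kMul k R M 1 x = x := by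
  induction x with
  | zero => simp
  | tmul m u => simp
  | add x y hx hy => simp [hx, hy]

theorem vMul_add (v w : DegV k) (x : M ⊗[k] DegV k) :
    vMul k R M (v + w) x = vMul k R M v x + vMul k R M w x := by
  induction x with
  | zero => simp
  | tmul m u => simp [add_mul, tmul_add]
  | add x y hx hy => simp only [map_add, hx, hy]; abel

theorem kMul_add (v w : DegK k) (x : M ⊗[k] DegK k) :
    kMul k R M (v + w) x = kMul k R M v x + kMul k R M w x := by
  induction x with
  | zero => simp
  | tmul m u => simp [add_mul, tmul_add]
  | add x y hx hy => simp only [map_add, hx, hy]; abel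

theorem vIncl_vMul (v : DegV k) (x : M ⊗[k] DegV k) :
    vIncl k R M (vMul k R M v x) = kMul k R M (algebraMap _ _ v) (vIncl k R M x) := by
  induction x with
  | zero => simp
  | tmul m u => simp
  | add x y hx hy => simp [hx, hy]

theorem vMul_iterate (n : ℕ) (v : DegV k) (x : M ⊗[k] DegV k) :
    (vMul k R M v)^[n] x = vMul k R M (v ^ n) x := by
  induction n with
  | zero => simp [vMul_one]
  | succ n ih => rw [Function.iterate_succ_apply', ih, pow_succ', vMul_mul]

theorem vMul_algebraMap (c : k) (x : M ⊗[k] DegV k) :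
    vMul k R M (algebraMap k _ c) x = algebraMap k R c • x := by
  induction x with
  | zero => simp
  | tmul m u => simp [← Algebra.smul_def, smul_tmul']
  | add x y hx hy => simp [hx, hy]

theorem kMul_injective {c : DegK k} (hc : IsUnit c) : Function.Injective (kMul k R M c) := by
  obtain ⟨d, hd⟩ := hc.exists_left_inv
  intro x y h
  have := congrArg (kMul k R M d) h
  rwa [← kMul_mul, ← kMul_mul, hd, kMul_one, kMul_one] at this

theorem vMul_injective {v : DegV k} (hv : v ≠ 0) : Function.Injective (vMul k R M v) :=
  Module.Flat.lTensor_preserves_injective_linearMap (M := M) (LinearMap.mulLeft k v)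
    (mul_right_injective₀ hv)

theorem vIncl_injective : Function.Injective (vIncl k R M) :=
  Module.Flat.lTensor_preserves_injective_linearMap (M := M)
    (IsScalarTower.toAlgHom k (DegV k) (DegK k)).toLinearMap (degK_injective k)

theorem kMul_pow_mem (x : M ⊗[k] DegK k) :
    ∃ n y, kMul k R M (kT k ^ n) x = vIncl k R M y := by
  induction x with
  | zero => exact ⟨0, 0, by simp⟩
  | tmul m u =>
    obtain ⟨n, v, h⟩ := degK_surj k u
    exact ⟨n, m ⊗ₜ v, by simp [h]⟩
  | add x y hx hy =>
    obtain ⟨n, u, hu⟩ := hx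
    obtain ⟨m, v, hv⟩ := hy
    refine ⟨n + m, vMul k R M (degT k ^ m) u + vMul k R M (degT k ^ n) v, ?_⟩
    rw [map_add, map_add, vIncl_vMul, vIncl_vMul, ← hu, ← hv, ← kMul_mul, ← kMul_mul, map_pow,
      map_pow, ← kT, ← pow_add, ← pow_add, add_comm m n]

theorem expE_T (x : M ⊗[k] DegV k) :
    expE k R M (vMul k R M (degT k) x) = seqShift (expE k R M x) := by
  funext i
  induction x with
  | zero => cases i <;> simp [seqShift]
  | tmul m u =>
    cases i with
    | zero => simp [seqShift, degCoeff_zero_t]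
    | succ i => simp [seqShift, degCoeff_succ_t]
  | add x y hx hy =>
    rw [map_add, map_add, Pi.add_apply, hx, hy, map_add]
    cases i <;> simp [seqShift]

theorem expE_decomp (x : M ⊗[k] DegV k) :
    ∃ y, x = expE k R M x 0 ⊗ₜ 1 + vMul k R M (degT k) y := by
  induction x with
  | zero => exact ⟨0, by simp⟩
  | tmul m u =>
    obtain ⟨v, hv⟩ := deg_decomp k u
    refine ⟨m ⊗ₜ v, ?_⟩
    rw [expE_tmul, smul_tmul, ← Algebra.algebraMap_eq_smul_one, vMul_tmul, ← tmul_add, ← hv]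
  | add x y hx hy =>
    obtain ⟨u, hu⟩ := hx
    obtain ⟨v, hv⟩ := hy
    refine ⟨u + v, ?_⟩
    rw [map_add, map_add, Pi.add_apply, add_tmul]
    nth_rw 1 [hu, hv]
    abel

theorem expE_zero (x : M ⊗[k] DegV k) (h : expE k R M x 0 = 0) :
    ∃ y, x = vMul k R M (degT k) y := by
  obtain ⟨y, hy⟩ := expE_decomp k R M x
  rw [h, zero_tmul, zero_add] at hy
  exact ⟨y, hy⟩

theorem expE_surj (m : M) : ∃ x, expE k R M x 0 = m :=
  ⟨m ⊗ₜ 1, by simp [degCoeff_one]⟩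

end Tensors

section FromDegenerates

variable (k : Type) [Field k] (R : Type) [Ring R] [Algebra k R]
  (M : Type) [AddCommGroup M] [Module R M] [Module k M] [IsScalarTower k R M]
  (N : Type) [AddCommGroup N] [Module R N]

theorem degB_aux [Module.Finite R M] (Q : Type) [AddCommGroup Q] [Module (R ⊗[k] DegV k) Q]
    [Module.Finite (R ⊗[k] DegV k) Q] (g : Q →+ M ⊗[k] DegK k)
    (hgr : ∀ (r : R) q, g ((r ⊗ₜ[k] (1 : DegV k)) • q) = r • g q)
    (hgv : ∀ (v : DegV k) q, g (((1 : R) ⊗ₜ[k] v) • q) =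
      kMul k R M (algebraMap _ _ v) (g q))
    (hinj : Function.Injective g)
    (hsurj : ∀ x, ∃ n q, g q = kMul k R M (kT k ^ n) x)
    (π : Q →+ N) (hπr : ∀ (r : R) q, π ((r ⊗ₜ[k] (1 : DegV k)) • q) = r • π q)
    (hπ : Function.Surjective π)
    (hker : ∀ q, π q = 0 ↔ ∃ q', q = ((1 : R) ⊗ₜ[k] degT k) • q') : DegB R M N := by
  have hsplit : ∀ (r : R) (v : DegV k) (q : Q), (r ⊗ₜ[k] v) • q =
      (r ⊗ₜ[k] (1 : DegV k)) • ((1 : R) ⊗ₜ[k] v) • q := by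
    intro r v q
    rw [← mul_smul, Algebra.TensorProduct.tmul_mul_tmul, mul_one, one_mul]
  -- bounded denominators
  have hb : ∃ n, ∀ q, ∃ y, vIncl k R M y = kMul k R M (kT k ^ n) (g q) := by
    obtain ⟨s, hs⟩ := (Module.Finite.fg_top : (⊤ : Submodule (R ⊗[k] DegV k) Q).FG)
    choose f y hf using fun q => kMul_pow_mem k R M (g q)
    refine ⟨s.sup f, fun q => ?_⟩
    have hq : q ∈ Submodule.span (R ⊗[k] DegV k) (s : Set Q) := by rw [hs]; trivial
    induction hq using Submodule.span_induction with
    | mem q hq =>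
      obtain ⟨d, hd⟩ := Nat.exists_eq_add_of_le (Finset.le_sup (f := f) hq)
      refine ⟨vMul k R M (degT k ^ d) (y q), ?_⟩
      rw [vIncl_vMul, ← hf, ← kMul_mul, map_pow, ← kT, ← pow_add, hd, add_comm]
    | zero => exact ⟨0, by simp⟩
    | add x z _ _ hx hz =>
      obtain ⟨u, hu⟩ := hx
      obtain ⟨v, hv⟩ := hz
      exact ⟨u + v, by simp [hu, hv]⟩
    | smul c x _ hx =>
      obtain ⟨u, hu⟩ := hx
      induction c with
      | zero => exact ⟨0, by simp⟩
      | tmul r v =>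
        refine ⟨r • vMul k R M v u, ?_⟩
        rw [hsplit, hgr, hgv, map_smul, map_smul, vIncl_vMul, hu, ← kMul_mul, ← kMul_mul, mul_comm]
      | add a b ha hb =>
        obtain ⟨u, hu⟩ := ha
        obtain ⟨v, hv⟩ := hb
        exact ⟨u + v, by simp [hu, hv, add_smul]⟩
  have hc : ∃ n, ∀ y, ∃ q, g q = kMul k R M (kT k ^ n) (vIncl k R M y) := by
    obtain ⟨s, hs⟩ := (Module.Finite.fg_top : (⊤ : Submodule R M).FG)
    choose f y hf using fun m : M => hsurj (m ⊗ₜ 1)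
    refine ⟨s.sup f, fun x => ?_⟩
    have key : ∀ m : M, ∃ q, g q = kMul k R M (kT k ^ (s.sup f)) (m ⊗ₜ 1) := by
      intro m
      have hm : m ∈ Submodule.span R (s : Set M) := by rw [hs]; trivial
      induction hm using Submodule.span_induction with
      | mem q hq =>
        obtain ⟨d, hd⟩ := Nat.exists_eq_add_of_le (Finset.le_sup (f := f) hq)
        refine ⟨((1 : R) ⊗ₜ[k] (degT k ^ d)) • y q, ?_⟩
        rw [hgv, hf, ← kMul_mul, map_pow, ← kT, ← pow_add, hd, add_comm]
      | zero => exact ⟨0, by simp⟩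
      | add x z _ _ hx hz =>
        obtain ⟨u, hu⟩ := hx
        obtain ⟨v, hv⟩ := hz
        exact ⟨u + v, by rw [map_add, hu, hv, add_tmul, map_add]⟩
      | smul c x _ hx =>
        obtain ⟨u, hu⟩ := hx
        exact ⟨(c ⊗ₜ[k] (1 : DegV k)) • u, by rw [hgr, hu, ← map_smul, smul_tmul']⟩
    induction x with
    | zero => exact ⟨0, by simp⟩
    | tmul m v =>
      obtain ⟨q, hq⟩ := key m
      refine ⟨((1 : R) ⊗ₜ[k] v) • q, ?_⟩
      rw [hgv, hq, ← kMul_mul, vIncl_tmul, kMul_tmul, kMul_tmul, mul_one, mul_comm]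
    | add a b ha hb =>
      obtain ⟨u, hu⟩ := ha
      obtain ⟨v, hv⟩ := hb
      exact ⟨u + v, by rw [map_add, hu, hv, map_add, map_add]⟩
  obtain ⟨n, hn⟩ := hb
  obtain ⟨m, hm⟩ := hc
  choose H hH using hn
  letI : Module R Q := rRestrict k R Q
  have hsm : ∀ (r : R) (q : Q), r • q = (r ⊗ₜ[k] (1 : DegV k)) • q := fun r q => rfl
  have hjinj := vIncl_injective k R M
  let h : Q →ₗ[R] M ⊗[k] DegV k :=
    { toFun := H
      map_add' := fun x y => hjinj (by rw [hH, map_add, map_add, map_add, hH, hH])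
      map_smul' := fun r x => hjinj (by
        rw [hH, hsm, hgr, map_smul, RingHom.id_apply, map_smul, hH]) }
  let π' : Q →ₗ[R] N :=
    { toFun := π
      map_add' := fun x y => map_add _ _ _
      map_smul' := fun r x => hπr r x }
  refine DegB.of_lattice (vMul k R M (degT k)) (expE k R M) (expE_T k R M) (expE_zero k R M)
    (expE_surj k R M) h ?_ (fun q => ((1 : R) ⊗ₜ[k] degT k) • q) ?_ (n + m) ?_ π' hπ hker
  · intro x y hxy
    have h1 : vIncl k R M (H x) = vIncl k R M (H y) := congrArg _ hxy
    rw [hH, hH] at h1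
    exact hinj (kMul_injective k R M ((kT_isUnit k).pow n) h1)
  · intro q
    apply hjinj
    show vIncl k R M (H _) = vIncl k R M (vMul k R M _ (H _))
    rw [hH, hgv, vIncl_vMul, hH, ← kMul_mul, ← kMul_mul, mul_comm]
  · intro u
    obtain ⟨q, hq⟩ := hm u
    refine ⟨q, hjinj ?_⟩
    show vIncl k R M (H _) = _
    rw [hH, hq, vMul_iterate, vIncl_vMul, ← kMul_mul, map_pow, ← kT, pow_add]

end FromDegenerates

theorem DegB.of_degenerates (k : Type) [Field k] (R : Type) [Ring R] [Algebra k R]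
    (M N : Type) [AddCommGroup M] [Module R M] [AddCommGroup N] [Module R N]
    [Module.Finite R M] (h : Degenerates k R M N) : DegB R M N := by
  obtain ⟨Q, _, _, hfin, hflat, ⟨e⟩, f, hfc, hfr⟩ := h
  letI : Module k M := Module.compHom M (algebraMap k R)
  haveI : IsScalarTower k R M := ⟨fun c r m => by
    rw [Algebra.smul_def, mul_smul]; rfl⟩
  letI := vRestrict k R Q
  have hvs : ∀ (v : DegV k) (q : Q), v • q = ((1 : R) ⊗ₜ[k] v) • q := fun _ _ => rfl
  have hfc' : ∀ (c : DegK k) (x : LocalizedModule (Submonoid.powers (degT k)) Q),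
      f (c • x) = kMul k R M c (f x) := hfc
  have hract : ∀ (r : R) (x : M ⊗[k] DegK k),
      LinearMap.rTensor (DegK k) (rActK k R M r) x = r • x := by
    intro r x
    induction x with
    | zero => simp
    | tmul m u => rfl
    | add x y hx hy => rw [map_add, hx, hy, smul_add]
  have hsmul : ∀ (v : DegV k) (q : Q), LocalizedModule.mk (v • q) (1 : Submonoid.powers (degT k))
      = algebraMap (DegV k) (DegK k) v • LocalizedModule.mk q 1 := by
    intro v q
    have h1 : algebraMap (DegV k) (DegK k) v = Localization.mk v 1 :=
      (Localization.mk_one_eq_algebraMap v).symm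
    rw [h1]
    refine ((LocalizedModule.mk_smul_mk (S := Submonoid.powers (degT k)) v q 1 1).trans ?_).symm
    rw [mul_one]
  let g : Q →+ M ⊗[k] DegK k :=
    f.toAddMonoidHom.comp (LocalizedModule.mkLinearMap (Submonoid.powers (degT k)) Q).toAddMonoidHom
  have hg : ∀ q, g q = f (LocalizedModule.mk q 1) := fun q => rfl
  let ρ := LinearMap.range (tSmul k R Q)
  letI := rRestrict k R (Q ⧸ ρ)
  refine degB_aux k R M N Q g ?_ ?_ ?_ ?_
    (e.toAddEquiv.toAddMonoidHom.comp ρ.mkQ.toAddMonoidHom) ?_ ?_ ?_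
  · intro r q
    rw [hg, hg, ← hract, ← hfr]
    congr 1
    exact (LocalizedModule.map_mk (Submonoid.powers (degT k)) (rAct k R Q r) q 1).symm
  · intro v q
    rw [hg, hg, ← hvs, hsmul, hfc']
  · intro x y hxy
    have h1 := f.injective hxy
    have h2 : LocalizedModule.mk x (1 : Submonoid.powers (degT k)) = LocalizedModule.mk y 1 := h1
    obtain ⟨⟨_, n, rfl⟩, hu⟩ := LocalizedModule.mk_eq.1 h2
    rw [one_smul, one_smul] at hu
    have hu' : (degT k ^ n) • x = (degT k ^ n) • y := hu
    exact (Module.IsTorsionFree.isSMulRegular (M := Q)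
      (IsRegular.of_ne_zero (pow_ne_zero n (degT_ne_zero k)))) hu'
  · intro x
    obtain ⟨z, rfl⟩ := f.surjective x
    induction z using LocalizedModule.induction_on with
    | h q s =>
      obtain ⟨_, n, rfl⟩ := s
      refine ⟨n, q, ?_⟩
      rw [hg, ← hfc']
      congr 1
      have h1 : kT k ^ n = Localization.mk (degT k ^ n) 1 := by
        rw [kT, ← map_pow]
        exact (Localization.mk_one_eq_algebraMap _).symm
      rw [h1]
      refine ((LocalizedModule.mk_smul_mk (S := Submonoid.powers (degT k)) _ q 1 _).trans ?_).symm
      rw [one_mul]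
      exact LocalizedModule.mk_cancel (S := Submonoid.powers (degT k)) ⟨_, n, rfl⟩ q
  · intro r q
    exact e.map_smul r (ρ.mkQ q)
  · exact e.surjective.comp ρ.mkQ_surjective
  · intro q
    show e (ρ.mkQ q) = 0 ↔ _
    rw [LinearEquiv.map_eq_zero_iff, Submodule.mkQ_apply, Submodule.Quotient.mk_eq_zero]
    constructor
    · rintro ⟨q', rfl⟩
      exact ⟨q', rfl⟩
    · rintro ⟨q', rfl⟩
      exact ⟨q', rfl⟩

section ToDegenerates

variable (k : Type) [Field k] (R : Type) [Ring R] [Algebra k R]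
  (M : Type) [AddCommGroup M] [Module R M] [Module k M] [IsScalarTower k R M]
  (N : Type) [AddCommGroup N] [Module R N]

/-- The `R ⊗ V`-module structure on `M ⊗ V`. -/
@[reducible] def rvModule : Module (R ⊗[k] DegV k) (M ⊗[k] DegV k) :=
  Module.compHom (M ⊗[k] DegV k)
    (((Module.endTensorEndAlgHom (R := k) (S := k) (A := k) (M := M) (N := DegV k)).comp
      (Algebra.TensorProduct.map (Algebra.lsmul k k M : R →ₐ[k] Module.End k M)
        (Algebra.lmul k (DegV k)))).toRingHom : R ⊗[k] DegV k →+* Module.End k (M ⊗[k] DegV k))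

theorem rv_smul (r : R) (v : DegV k) (x : M ⊗[k] DegV k) :
    letI := rvModule k R M
    (r ⊗ₜ[k] v) • x = r • vMul k R M v x := by
  letI := rvModule k R M
  show (r ⊗ₜ[k] v) • x = r • vMul k R M v x
  induction x with
  | zero => rw [smul_zero, map_zero, smul_zero]
  | tmul m u => rfl
  | add x y hx hy => rw [smul_add, hx, hy, map_add, smul_add]

/-- The `V`-module structure on `M ⊗ K`. -/
@[reducible] def kvModule : Module (DegV k) (M ⊗[k] DegK k) where
  smul v x := kMul k R M (algebraMap _ _ v) x
  one_smul x := by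
    show kMul k R M (algebraMap _ _ 1) x = x
    rw [map_one, kMul_one]
  mul_smul v w x := by
    show kMul k R M (algebraMap _ _ (v * w)) x = kMul k R M _ (kMul k R M _ x)
    rw [map_mul, kMul_mul]
  smul_zero v := map_zero _
  smul_add v x y := map_add _ _ _
  add_smul v w x := by
    show kMul k R M (algebraMap _ _ (v + w)) x = kMul k R M _ x + kMul k R M _ x
    rw [map_add, kMul_add]
  zero_smul x := by
    show kMul k R M (algebraMap _ _ 0) x = 0
    induction x with
    | zero => simp
    | tmul m u => simp
    | add x y hx hy => rw [map_add, hx, hy, add_zero]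

theorem stable_aux (a : ℕ) (Q : Submodule R (M ⊗[k] DegV k))
    (hT : ∀ u ∈ Q, vMul k R M (degT k) u ∈ Q) (ha : ∀ u, (vMul k R M (degT k))^[a] u ∈ Q)
    (v : DegV k) (u : M ⊗[k] DegV k) (hu : u ∈ Q) : vMul k R M v u ∈ Q := by
  have key : ∀ (b : ℕ) (v : DegV k), ∃ w, vMul k R M v u - (vMul k R M (degT k))^[b] w ∈ Q := by
    intro b
    induction b with
    | zero => intro v; exact ⟨vMul k R M v u, by simp⟩
    | succ b ih =>
      intro v
      obtain ⟨v', hv'⟩ := deg_decomp k v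
      obtain ⟨w, hw⟩ := ih v'
      refine ⟨w, ?_⟩
      have h1 := Q.add_mem (Q.smul_mem (algebraMap k R (degCoeff k 0 v)) hu) (hT _ hw)
      rw [← vMul_algebraMap, map_sub, ← vMul_mul, ← add_sub_assoc, ← vMul_add, ← hv'] at h1
      rwa [Function.iterate_succ_apply']
  obtain ⟨w, hw⟩ := key a v
  have := Q.add_mem hw (ha w)
  simpa using this

theorem degenerates_aux [Module.Finite R M] [Module.Finite R N] (h : DegB R M N) :
    ∃ (Q : Type) (_ : AddCommGroup Q) (_ : Module (R ⊗[k] DegV k) Q),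
    Module.Finite (R ⊗[k] DegV k) Q ∧
    (letI := vRestrict k R Q; Module.Flat (DegV k) Q) ∧
    (letI := rRestrict k R (Q ⧸ LinearMap.range (tSmul k R Q))
     Nonempty ((Q ⧸ LinearMap.range (tSmul k R Q)) ≃ₗ[R] N)) ∧
    (letI := vRestrict k R Q
     ∃ f : LocalizedModule (Submonoid.powers (degT k)) Q ≃+ (M ⊗[k] DegK k),
       (∀ (c : DegK k) (x : LocalizedModule (Submonoid.powers (degT k)) Q),
          f (c • x) = kMul k R M c (f x)) ∧
       (∀ (r : R) (x : LocalizedModule (Submonoid.powers (degT k)) Q),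
          f (LocalizedModule.map (Submonoid.powers (degT k)) (rAct k R Q r) x)
            = r • (f x))) := by
  obtain ⟨a, Q0, π, hπ, hT, hker, ha⟩ := DegB.lattice (vMul k R M (degT k)) (expE k R M) h
    (expE_T k R M) (expE_zero k R M) (expE_surj k R M)
  letI := rvModule k R M
  have hsm : ∀ (r : R) (v : DegV k) (x : M ⊗[k] DegV k), (r ⊗ₜ[k] v) • x = r • vMul k R M v x :=
    rv_smul k R M
  have hst := stable_aux k R M a Q0 hT ha
  let Q : Submodule (R ⊗[k] DegV k) (M ⊗[k] DegV k) :=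
    { carrier := Q0
      zero_mem' := Q0.zero_mem
      add_mem' := Q0.add_mem
      smul_mem' := by
        intro c x hx
        induction c with
        | zero => rw [zero_smul]; exact Q0.zero_mem
        | tmul r v => rw [hsm]; exact Q0.smul_mem r (hst v x hx)
        | add c d hc hd => rw [add_smul]; exact Q0.add_mem hc hd }
  have hmemQ : ∀ x, x ∈ Q ↔ x ∈ Q0 := fun x => Iff.rfl
  have hone : ∀ (v : DegV k) (x : M ⊗[k] DegV k), ((1 : R) ⊗ₜ[k] v) • x = vMul k R M v x := by
    intro v x; rw [hsm, one_smul]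
  have hr1 : ∀ (r : R) (x : M ⊗[k] DegV k), (r ⊗ₜ[k] (1 : DegV k)) • x = r • x := by
    intro v x; rw [hsm, vMul_one]
  refine ⟨Q, inferInstance, inferInstance, ?_, ?_, ?_, ?_⟩
  · rw [Module.Finite.iff_fg]
    obtain ⟨s, hs⟩ := (Module.Finite.fg_top : (⊤ : Submodule R N).FG)
    obtain ⟨s', hs'⟩ := (Module.Finite.fg_top : (⊤ : Submodule R M).FG)
    classical
    obtain ⟨σ, hσ⟩ : ∃ σ : N → Q0, ∀ n, π (σ n) = n :=
      ⟨Function.surjInv hπ, Function.surjInv_eq hπ⟩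
    let A : Finset (M ⊗[k] DegV k) := s.image (fun n => (σ n : M ⊗[k] DegV k)) ∪
      s'.image (fun m => (vMul k R M (degT k))^[a] (m ⊗ₜ[k] (1 : DegV k)))
    refine ⟨A, le_antisymm ?_ ?_⟩
    · rw [Submodule.span_le]
      intro x hx
      simp only [A, Finset.coe_union, Finset.coe_image] at hx
      rcases hx with ⟨n, _, rfl⟩ | ⟨m, _, rfl⟩
      · exact (σ n).2
      · exact ha _
    · set P := Submodule.span (R ⊗[k] DegV k) (A : Set (M ⊗[k] DegV k)) with hP
      have hPr : ∀ (r : R) x, x ∈ P → r • x ∈ P := by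
        intro r x hx
        rw [← hr1]
        exact P.smul_mem _ hx
      have hPv : ∀ (v : DegV k) x, x ∈ P → vMul k R M v x ∈ P := by
        intro r x hx
        rw [← hone]
        exact P.smul_mem _ hx
      have hA : ∀ u, (vMul k R M (degT k))^[a] u ∈ P := by
        have key : ∀ m : M, (vMul k R M (degT k))^[a] (m ⊗ₜ[k] (1 : DegV k)) ∈ P := by
          intro m
          have hm : m ∈ Submodule.span R (s' : Set M) := by rw [hs']; trivial
          rw [vMul_iterate]
          induction hm using Submodule.span_induction with
          | mem q hq =>
            rw [← vMul_iterate]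
            apply Submodule.subset_span
            exact Finset.mem_coe.2 (Finset.mem_union_right _ (Finset.mem_image_of_mem _ hq))
          | zero => simp
          | add x z _ _ hx hz => rw [add_tmul, map_add]; exact P.add_mem hx hz
          | smul c x _ hx => rw [← smul_tmul', map_smul]; exact hPr _ _ hx
        intro u
        rw [vMul_iterate]
        induction u with
        | zero => rw [map_zero]; exact P.zero_mem
        | tmul m v =>
          have := hPv v _ (key m)
          rw [vMul_iterate, vMul_tmul, vMul_tmul] at this
          rw [vMul_tmul]
          rwa [mul_one, mul_comm] at this
        | add x y hx hy => rw [map_add]; exact P.add_mem hx hy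
      have hN : ∀ n : N, ∃ q : Q0, (q : M ⊗[k] DegV k) ∈ P ∧ π q = n := by
        intro n
        have hn : n ∈ Submodule.span R (s : Set N) := by rw [hs]; trivial
        induction hn using Submodule.span_induction with
        | mem n hn =>
          refine ⟨σ n, ?_, hσ n⟩
          apply Submodule.subset_span
          exact Finset.mem_coe.2 (Finset.mem_union_left _
            (Finset.mem_image_of_mem (fun n => (σ n : M ⊗[k] DegV k)) hn))
        | zero => exact ⟨0, P.zero_mem, map_zero _⟩
        | add x z _ _ hx hz =>
          obtain ⟨q, h1, h2⟩ := hx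
          obtain ⟨q', h1', h2'⟩ := hz
          exact ⟨q + q', P.add_mem h1 h1', by rw [map_add, h2, h2']⟩
        | smul c x _ hx =>
          obtain ⟨q, h1, h2⟩ := hx
          exact ⟨c • q, hPr _ _ h1, by rw [map_smul, h2]⟩
      have hb : ∀ (b : ℕ) (u : M ⊗[k] DegV k), u ∈ Q0 → ∃ p ∈ P, ∃ u' ∈ Q0,
          u = p + (vMul k R M (degT k))^[b] u' := by
        intro b
        induction b with
        | zero => intro u hu; exact ⟨0, P.zero_mem, u, hu, by simp⟩
        | succ b ih =>
          intro u hu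
          obtain ⟨p, hp, u', hu', rfl⟩ := ih u hu
          obtain ⟨q, hq, hq'⟩ := hN (π ⟨u', hu'⟩)
          obtain ⟨u'', hu'', he⟩ := (hker (⟨u', hu'⟩ - q)).1 (by rw [map_sub, hq', sub_self])
          refine ⟨p + (vMul k R M (degT k))^[b] q, P.add_mem hp ?_, u'', hu'', ?_⟩
          · rw [vMul_iterate]; exact hPv _ _ hq
          · have he' : u' = q + vMul k R M (degT k) u'' := by
              rw [← he]; simp
            rw [Function.iterate_succ_apply, add_assoc]
            congr 1
            rw [vMul_iterate, vMul_iterate, vMul_iterate, ← map_add, ← he']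
      intro u hu
      obtain ⟨p, hp, u', _, rfl⟩ := hb a u hu
      exact P.add_mem hp (hA u')
  · letI := vRestrict k R Q
    haveI : Module.IsTorsionFree (DegV k) Q := ⟨by
      intro v hv x y hxy
      apply Subtype.ext
      apply vMul_injective k R M hv.ne_zero
      have h1 := congrArg Subtype.val hxy
      rw [← hone, ← hone]
      exact h1⟩
    infer_instance
  · letI := rRestrict k R (Q ⧸ LinearMap.range (tSmul k R Q))
    let ρ := LinearMap.range (tSmul k R Q)
    let π1 : Q →+ N := π.toAddMonoidHom
    have hk1 : ∀ q : Q, π1 q = 0 ↔ q ∈ ρ := by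
      intro q
      refine (hker q).trans ⟨?_, ?_⟩
      · rintro ⟨u, hu, he⟩
        refine ⟨⟨u, hu⟩, Subtype.ext ?_⟩
        rw [he, ← hone]
        rfl
      · rintro ⟨u, rfl⟩
        exact ⟨u, u.2, by rw [← hone]; rfl⟩
    let ψ : (Q ⧸ ρ) →+ N := QuotientAddGroup.lift ρ.toAddSubgroup π1 (fun q hq => (hk1 q).2 hq)
    have hψ : ∀ q : Q, ψ (ρ.mkQ q) = π1 q := fun q => rfl
    refine ⟨LinearEquiv.ofBijective
      { toFun := ψ
        map_add' := map_add ψ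
        map_smul' := ?_ } ⟨?_, ?_⟩⟩
    · intro r x
      obtain ⟨q, rfl⟩ := ρ.mkQ_surjective x
      have h1 : r • ρ.mkQ q = ρ.mkQ ((r ⊗ₜ[k] (1 : DegV k)) • q) := rfl
      rw [h1, hψ, hψ]
      have h2 : ((r ⊗ₜ[k] (1 : DegV k)) • q : Q) = (r • (show Q0 from q) : Q0) :=
        Subtype.ext (hr1 r q)
      rw [h2]
      exact π.map_smul r q
    · intro x y hxy
      obtain ⟨q, rfl⟩ := ρ.mkQ_surjective x
      obtain ⟨q', rfl⟩ := ρ.mkQ_surjective y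
      have h1 : π1 q = π1 q' := hxy
      rw [← sub_eq_zero, ← map_sub, hk1] at h1
      exact (Submodule.Quotient.eq ρ).2 h1
    · intro n
      obtain ⟨q, hq⟩ := hπ n
      exact ⟨ρ.mkQ q, hq⟩
  · letI := vRestrict k R Q
    letI := kvModule k R M
    have hvs : ∀ (v : DegV k) (x : M ⊗[k] DegK k), v • x = kMul k R M (algebraMap _ _ v) x :=
      fun _ _ => rfl
    have hvq : ∀ (v : DegV k) (x : Q), ((v • x : Q) : M ⊗[k] DegV k) = vMul k R M v x :=
      fun v x => hone v x
    let g : Q →ₗ[DegV k] M ⊗[k] DegK k :=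
      { toFun := fun q => vIncl k R M q
        map_add' := fun x y => by rw [Submodule.coe_add, map_add]
        map_smul' := fun v x => by
          rw [hvq, vIncl_vMul]; rfl }
    have hg : ∀ q : Q, g q = vIncl k R M q := fun _ => rfl
    haveI : IsLocalizedModule (Submonoid.powers (degT k)) g :=
      { map_units := by
          rintro ⟨_, n, rfl⟩
          rw [Module.End.isUnit_iff]
          have hu : IsUnit (algebraMap (DegV k) (DegK k) (degT k ^ n)) := by
            rw [map_pow]; exact (kT_isUnit k).pow n
          constructor
          · exact kMul_injective k R M hu
          · intro x
            obtain ⟨d, hd⟩ := hu.exists_right_inv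
            refine ⟨kMul k R M d x, ?_⟩
            show kMul k R M _ (kMul k R M d x) = x
            rw [← kMul_mul, hd, kMul_one]
        surj := by
          intro x
          obtain ⟨n, y, hy⟩ := kMul_pow_mem k R M x
          refine ⟨⟨⟨(vMul k R M (degT k))^[a] y, ha y⟩, ⟨degT k ^ (a + n), a + n, rfl⟩⟩, ?_⟩
          show kMul k R M (algebraMap _ _ (degT k ^ (a + n))) x =
            vIncl k R M ((vMul k R M (degT k))^[a] y)
          rw [vMul_iterate, vIncl_vMul, ← hy, ← kMul_mul, map_pow, map_pow, pow_add]
          rfl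
        exists_of_eq := by
          intro x y hxy
          exact ⟨1, by rw [Subtype.ext (vIncl_injective k R M hxy)]⟩ }
    let f := IsLocalizedModule.iso (Submonoid.powers (degT k)) g
    have hf1 : ∀ q, f (LocalizedModule.mk q 1) = g q := fun q => IsLocalizedModule.iso_mk_one _ _ q
    have hfv : ∀ (v : DegV k) x, f (v • x) = kMul k R M (algebraMap _ _ v) (f x) :=
      fun v x => f.map_smul v x
    have htower : ∀ (v : DegV k) (x : LocalizedModule (Submonoid.powers (degT k)) Q),
        algebraMap (DegV k) (DegK k) v • x = v • x := fun v x =>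
      algebraMap_smul (R := DegV k) (Localization (Submonoid.powers (degT k))) v x
    refine ⟨f.toAddEquiv, ?_, ?_⟩
    · intro c x
      show f (c • x) = kMul k R M c (f x)
      obtain ⟨n, v, hc⟩ := degK_surj k c
      apply kMul_injective k R M ((kT_isUnit k).pow n)
      rw [← kMul_mul, hc, ← hfv, ← htower, ← hc, mul_smul, kT, ← map_pow, htower, hfv]
    · intro r x
      show f _ = r • f x
      induction x using LocalizedModule.induction_on with
      | h q s =>
        have h2 : LocalizedModule.map (Submonoid.powers (degT k)) (rAct k R Q r)
            (LocalizedModule.mk q s) = LocalizedModule.mk (rAct k R Q r q) s :=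
          LocalizedModule.map_mk (Submonoid.powers (degT k)) (rAct k R Q r) q s
        have h3 : ∀ q : Q, (s : DegV k) • LocalizedModule.mk q s = LocalizedModule.mk q 1 := by
          intro q
          rw [LocalizedModule.smul'_mk]
          exact LocalizedModule.mk_cancel s q
        rw [h2]
        apply kMul_injective k R M
          (IsLocalization.map_units (DegK k) (s : Submonoid.powers (degT k)))
        rw [← hfv, (kMul k R M _).map_smul, ← hfv, h3, h3, hf1, hf1, hg, hg, ← map_smul, ← hr1]
        rfl

end ToDegenerates

theorem DegB.degenerates (k : Type) [Field k] (R : Type) [Ring R] [Algebra k R]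
    (M N : Type) [AddCommGroup M] [Module R M] [AddCommGroup N] [Module R N]
    [Module.Finite R M] [Module.Finite R N] (h : DegB R M N) : Degenerates k R M N := by
  letI : Module k M := Module.compHom M (algebraMap k R)
  haveI : IsScalarTower k R M := ⟨fun c r m => by
    rw [Algebra.smul_def, mul_smul]; rfl⟩
  have hract : ∀ (r : R) (x : M ⊗[k] DegK k),
      LinearMap.rTensor (DegK k) (rActK k R M r) x = r • x := by
    intro r x
    induction x with
    | zero => simp
    | tmul m u => rfl
    | add x y hx hy => rw [map_add, hx, hy, smul_add]
  obtain ⟨Q, i1, i2, h1, h2, h3, f, hc, hr⟩ := degenerates_aux k R M N h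
  refine ⟨Q, i1, i2, h1, h2, h3, f, hc, fun r x => ?_⟩
  rw [hract]
  exact hr r x

theorem finProdPow {R M : Type} [Ring R] [AddCommGroup M] [Module R M] (m n : ℕ) :
    Nonempty ((Fin (m * n) → M) ≃ₗ[R] (Fin m → Fin n → M)) :=
  ⟨(LinearEquiv.funCongrLeft R M finProdFinEquiv).trans (LinearEquiv.curry R M (Fin m) (Fin n))⟩

/-- if `M^{⊕n} ⇒_deg N^{⊕n}` for some `n > 0` then `𝒞(N) ⊆ 𝒞(M)`. -/
theorem CC_mono_of_degenerates (k : Type) [Field k] (R : Type) [Ring R] [Algebra k R]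
    (M N : FGMod R) (n : ℕ) (hn : 0 < n)
    (h : Degenerates k R (Fin n → M.carrier) (Fin n → N.carrier)) :
    CC k R {N} ⊆ CC k R {M} := by

  rintro L ⟨N', hN', m, hm, h'⟩
  obtain rfl : N' = N := hN'
  refine ⟨M, rfl, m * n, Nat.mul_pos hm hn, ?_⟩
  have h1 := (DegB.of_degenerates k R _ _ h).pi m
  have h2 := (DegB.of_degenerates k R _ _ h').pi n
  obtain ⟨eM⟩ := finProdPow (R := R) (M := M.carrier) m n
  obtain ⟨eN⟩ := finProdPow (R := R) (M := N'.carrier) m n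
  obtain ⟨eN'⟩ := finProdPow (R := R) (M := N'.carrier) n m
  obtain ⟨eL⟩ := finProdPow (R := R) (M := L.carrier) n m
  have h3 := h1.congr eM eN
  have h4 := h2.congr eN' eL
  rw [mul_comm n m] at h4
  exact (h3.trans h4).degenerates k R
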